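/- Suppose condition (B_p) holds for some p > 1, and conditions (M_C) and (Q_∞) hold. Then: (i) if Σ_{i∈S} d_i π(i) > 0, then (X_n) is transient; (ii) if Σ_{i∈S} d_i π(i) < 0, then (X_n) is positive-recurrent. -/

import Mathlib

open MeasureTheory Filter Topology Asymptotics
open scoped ENNReal NNReal

/-- A time-homogeneous Markov chain on a measurable state space `E`, encoded via the family
`P z` of laws (on trajectory space) of the chain started at `z`.  The field `markov` is the
time-homogeneous Markov property: conditionally on the event `{ω n = w}` intersected with any
event `B` depending only on the first `n+1` coordinates, the shifted trajectory has law `P w`. -/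
structure MChain (E : Type*) [MeasurableSpace E] where
  P : E → MeasureTheory.Measure (ℕ → E)
  isProb : ∀ z, MeasureTheory.IsProbabilityMeasure (P z)
  init : ∀ z, P z {ω | ω 0 = z} = 1
  markov : ∀ (z : E) (n : ℕ) (w : E) (A B : Set (ℕ → E)), MeasurableSet A →
    (∀ ω ω' : ℕ → E, (∀ k, k ≤ n → ω k = ω' k) → ω ∈ B → ω' ∈ B) →
    P z (B ∩ {ω | ω n = w} ∩ {ω | (fun k => ω (n + k)) ∈ A})
      = P z (B ∩ {ω | ω n = w}) * P w A

namespace MChain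

variable {E : Type*} [MeasurableSpace E]

/-- Irreducibility: every state can be reached from every state with positive probability. -/
def Irreducible (X : MChain E) : Prop := ∀ z w : E, ∃ n : ℕ, X.P z {ω | ω n = w} ≠ 0

/-- Recurrence: from every state, the chain returns to it almost surely. -/
def Recurrent (X : MChain E) : Prop := ∀ z : E, X.P z {ω | ∃ n, 1 ≤ n ∧ ω n = z} = 1

def Transient (X : MChain E) : Prop := ¬ X.Recurrent

/-- The first return time to `z` (with junk value `0`, via `sInf ∅ = 0`, if there is no return). -/
noncomputable def returnTime (z : E) (ω : ℕ → E) : ℕ := sInf {n | 1 ≤ n ∧ ω n = z}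

/-- Positive recurrence: recurrent, with finite mean return times. -/
def PositiveRecurrent (X : MChain E) : Prop :=
  X.Recurrent ∧ ∀ z : E, (∫⁻ ω, (returnTime z ω : ℝ≥0∞) ∂(X.P z)) ≠ ⊤

def NullRecurrent (X : MChain E) : Prop := X.Recurrent ∧ ¬ X.PositiveRecurrent

end MChain

section HalfStrip

variable {S : Type*} [Fintype S] [DecidableEq S] [Nonempty S]
  [MeasurableSpace S] [MeasurableSingletonClass S]

/-- `qhat X x i j` is the probability that the `S`-coordinate moves from `i` to `j` when the
`ℕ`-coordinate is at `x`; this is `q_x(i,j) = Σ_y p(x,i,y,j)` of the paper. -/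
noncomputable def qhat (X : MChain (ℕ × S)) (x : ℕ) (i j : S) : ℝ :=
  (X.P (x, i) {ω | (ω 1).2 = j}).toReal

/-- `stepMoment X k x i = μ_k(x,i) = E[(X_{n+1}-X_n)^k | X_n = x, η_n = i]`. -/
noncomputable def stepMoment (X : MChain (ℕ × S)) (k : ℕ) (x : ℕ) (i : S) : ℝ :=
  ∫ ω, (((ω 1).1 : ℝ) - (x : ℝ)) ^ k ∂(X.P (x, i))

/-- Condition (B_p): uniformly bounded conditional `p`-th moments of the jumps of the
`ℕ`-coordinate (by the Markov property, the conditional moment given `F_n` is a function of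
the current state only). -/
def CondB (X : MChain (ℕ × S)) (p : ℝ) : Prop :=
  ∃ C : ℝ≥0∞, C ≠ ⊤ ∧ ∀ (x : ℕ) (i : S),
    (∫⁻ ω, ENNReal.ofReal (|((ω 1).1 : ℝ) - (x : ℝ)| ^ p) ∂(X.P (x, i))) ≤ C

def IsStochasticMatrix (Q : S → S → ℝ) : Prop :=
  (∀ i j, 0 ≤ Q i j) ∧ ∀ i, (∑ j, Q i j) = 1

def IsIrreducibleMatrix (Q : S → S → ℝ) : Prop :=
  ∀ i j, ∃ n : ℕ, 0 < ((Matrix.of Q) ^ n) i j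

/-- Aperiodicity (for a finite irreducible stochastic matrix, eventual positivity of the
diagonal entries of the powers is equivalent to aperiodicity). -/
def IsAperiodicMatrix (Q : S → S → ℝ) : Prop :=
  ∀ i, ∃ N : ℕ, ∀ n, N ≤ n → 0 < ((Matrix.of Q) ^ n) i i

/-- `pst` is a (strictly positive) stationary distribution for `Q`. -/
def IsStationaryDist (Q : S → S → ℝ) (pst : S → ℝ) : Prop :=
  (∀ i, 0 < pst i) ∧ (∑ i, pst i) = 1 ∧ ∀ j, (∑ i, pst i * Q i j) = pst j

/-- Condition (Q_∞): the transition matrix of the `S`-coordinate converges as `x → ∞` to an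
irreducible stochastic matrix `Q`. -/
def CondQ (X : MChain (ℕ × S)) (Q : S → S → ℝ) : Prop :=
  (∀ i j, Tendsto (fun x : ℕ => qhat X x i j) atTop (nhds (Q i j))) ∧
    IsStochasticMatrix Q ∧ IsIrreducibleMatrix Q

/-- Condition (Q_∞^+): as (Q_∞), with a power-law rate of convergence. -/
def CondQplus (X : MChain (ℕ × S)) (Q : S → S → ℝ) : Prop :=
  (∃ δ₀ : ℝ, 0 < δ₀ ∧ ∀ i j,
      (fun x : ℕ => qhat X x i j - Q i j) =O[atTop] fun x : ℕ => (x : ℝ) ^ (-δ₀)) ∧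
    IsStochasticMatrix Q ∧ IsIrreducibleMatrix Q

/-- Condition (M_C): asymptotically constant drifts, `μ₁(x,i) = d_i + o(1)`. -/
def CondMC (X : MChain (ℕ × S)) (d : S → ℝ) : Prop :=
  ∀ i, Tendsto (fun x : ℕ => stepMoment X 1 x i) atTop (nhds (d i))

/-- Condition (M_L): Lamperti-type drifts, `μ₁(x,i) = c_i/x + o(1/x)`, `μ₂(x,i) = s_i² + o(1)`,
with at least one `s_i²` nonzero. -/
def CondML (X : MChain (ℕ × S)) (c s2 : S → ℝ) : Prop :=
  (∀ i, 0 ≤ s2 i) ∧ (∃ i, s2 i ≠ 0) ∧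
    (∀ i, Tendsto (fun x : ℕ => (x : ℝ) * stepMoment X 1 x i) atTop (nhds (c i))) ∧
    (∀ i, Tendsto (fun x : ℕ => stepMoment X 2 x i) atTop (nhds (s2 i)))

/-- Condition (M_L^+): Lamperti-type drifts with power-law error bounds. -/
def CondMLplus (X : MChain (ℕ × S)) (c s2 : S → ℝ) : Prop :=
  (∀ i, 0 ≤ s2 i) ∧ (∃ i, s2 i ≠ 0) ∧
    ∃ δ₁ : ℝ, 0 < δ₁ ∧ ∀ i,
      ((fun x : ℕ => stepMoment X 1 x i - c i / (x : ℝ)) =O[atTop]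
        fun x : ℕ => (x : ℝ) ^ (-1 - δ₁)) ∧
      ((fun x : ℕ => stepMoment X 2 x i - s2 i) =O[atTop] fun x : ℕ => (x : ℝ) ^ (-δ₁))

/-- Successive visit times `τ_0 < τ_1 < ⋯` of the `S`-coordinate to the distinguished state
`s0` (junk value, via `sInf ∅ = 0`, if there is no such visit). -/
noncomputable def tauSeq (s0 : S) (ω : ℕ → ℕ × S) : ℕ → ℕ
  | 0 => sInf {n | (ω n).2 = s0}
  | m + 1 => sInf {n | tauSeq s0 ω m < n ∧ (ω n).2 = s0}

/-- `τ`, the first positive time at which the `S`-coordinate visits `s0`. -/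
noncomputable def tauRet (s0 : S) (ω : ℕ → ℕ × S) : ℕ :=
  sInf {n | 1 ≤ n ∧ (ω n).2 = s0}

/-- `D_n`, the maximal displacement of the `ℕ`-coordinate during the `n`-th excursion. -/
noncomputable def Dexc (s0 : S) (n : ℕ) (ω : ℕ → ℕ × S) : ℕ :=
  Finset.sup (Finset.Icc (tauSeq s0 ω n) (tauSeq s0 ω (n + 1)))
    fun m => Nat.dist (ω m).1 (ω (tauSeq s0 ω n)).1

/-- `N(n) = max {k : τ_k ≤ n}`. -/
noncomputable def Ncount (s0 : S) (n : ℕ) (ω : ℕ → ℕ × S) : ℕ :=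
  sSup {k | tauSeq s0 ω k ≤ n}

end HalfStrip

/-- `Fdist a t` is the distribution function of the square root of a `Gamma(a,t)` random
variable: `F_{a,t}(x) = ∫_0^x 2 u^{2a-1} e^{-u²/t} / (t^a Γ(a)) du`. -/
noncomputable def Fdist (a t x : ℝ) : ℝ :=
  ∫ u in (0:ℝ)..x, 2 * u ^ (2 * a - 1) * Real.exp (-(u ^ 2) / t) / (t ^ a * Real.Gamma a)

variable {S : Type*} [Fintype S] [DecidableEq S] [Nonempty S]
  [MeasurableSpace S] [MeasurableSingletonClass S]

namespace MChain

section Abstract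

variable {E : Type*} [MeasurableSpace E]

instance (X : MChain E) (z : E) : IsProbabilityMeasure (X.P z) := X.isProb z

/-- The trajectories that do not visit `a` at the times `1, …, n`. -/
def avoid (a : E) (n : ℕ) : Set (ℕ → E) := {ω | ∀ k, 1 ≤ k → k ≤ n → ω k ≠ a}

/-- The one-step transition operator killed on entering `a`. -/
noncomputable def killedStep (X : MChain E) (a : E) (g : E → ℝ≥0∞) (z : E) : ℝ≥0∞ :=
  ∫⁻ ω, ({a}ᶜ : Set E).indicator g (ω 1) ∂(X.P z)

/-- `expReturn a n z` is the expectation under `P z` of the minimum of `n` and the first positive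
time at which the chain visits `a`. -/
noncomputable def expReturn (X : MChain E) (a : E) (n : ℕ) (z : E) : ℝ≥0∞ :=
  ∑ k ∈ Finset.range n, X.P z (avoid a k)

lemma measurable_shift (n : ℕ) : Measurable fun (ω : ℕ → E) k => ω (n + k) :=
  measurable_pi_iff.2 fun k => measurable_pi_apply (n + k)

lemma avoid_antitone {F : Type*} (a : F) : Antitone (avoid a) :=
  fun _ _ h _ hω k hk hkm => hω k hk (hkm.trans h)

lemma measure_avoid_zero (X : MChain E) (a z : E) : X.P z (avoid a 0) = 1 := by
  have : avoid a 0 = Set.univ := by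
    refine Set.eq_univ_of_forall fun ω k hk hk' => ?_
    omega
  rw [this, measure_univ]

lemma killedStep_mono (X : MChain E) (a : E) {g h : E → ℝ≥0∞} (hgh : g ≤ h) :
    X.killedStep a g ≤ X.killedStep a h := fun _ =>
  lintegral_mono fun ω => Set.indicator_le_indicator (hgh (ω 1))

lemma killedStep_le (X : MChain E) (a : E) (g : E → ℝ≥0∞) (z : E) :
    X.killedStep a g z ≤ ∫⁻ ω, g (ω 1) ∂(X.P z) :=
  lintegral_mono fun ω => Set.indicator_le_self _ _ (ω 1)

lemma expReturn_le (X : MChain E) (a : E) (n : ℕ) (z : E) : X.expReturn a n z ≤ n := by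
  calc X.expReturn a n z ≤ ∑ k ∈ Finset.range n, 1 := Finset.sum_le_sum fun _ _ => prob_le_one
    _ = n := by simp

lemma expReturn_mono (X : MChain E) (a z : E) : Monotone fun n => X.expReturn a n z :=
  fun _ _ h => Finset.sum_le_sum_of_subset (Finset.range_mono h)

variable [Countable E] [MeasurableSingletonClass E]

lemma measurable_comp_eval (g : E → ℝ≥0∞) (n : ℕ) : Measurable fun ω : ℕ → E => g (ω n) :=
  (measurable_of_countable g).comp (measurable_pi_apply n)

lemma measurableSet_eval (D : Set E) (n : ℕ) : MeasurableSet {ω : ℕ → E | ω n ∈ D} :=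
  measurable_pi_apply n D.to_countable.measurableSet

lemma measurableSet_avoid (a : E) (n : ℕ) : MeasurableSet (avoid a n) := by
  have : avoid a n = ⋂ k, ⋂ (_ : 1 ≤ k), ⋂ (_ : k ≤ n), {ω : ℕ → E | ω k ∈ ({a}ᶜ : Set E)} := by
    ext ω; simp [avoid]
  rw [this]
  exact .iInter fun k => .iInter fun _ => .iInter fun _ => measurableSet_eval _ k

lemma ae_start (X : MChain E) (z : E) : ∀ᵐ ω ∂(X.P z), ω 0 = z := by
  have h : MeasurableSet {ω : ℕ → E | ω 0 = z} := measurableSet_eval {z} 0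
  exact (prob_compl_eq_zero_iff h).2 (X.init z)

lemma measure_step (X : MChain E) (z : E) (D : Set E) {A : Set (ℕ → E)} (hA : MeasurableSet A) :
    X.P z {ω | ω 1 ∈ D ∧ (fun k => ω (1 + k)) ∈ A}
      = ∫⁻ ω, D.indicator (fun w => X.P w A) (ω 1) ∂(X.P z) := by
  have hev : Measurable fun ω : ℕ → E => ω 1 := measurable_pi_apply 1
  have hmap : ∫⁻ ω, D.indicator (fun w => X.P w A) (ω 1) ∂(X.P z)
      = ∑' w, D.indicator (fun w => X.P w A) w * X.P z {ω | ω 1 = w} := by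
    rw [← lintegral_map (measurable_of_countable _) hev, lintegral_countable']
    refine tsum_congr fun w => ?_
    rw [Measure.map_apply hev (measurableSet_singleton w)]
    rfl
  have hun : {ω : ℕ → E | ω 1 ∈ D ∧ (fun k => ω (1 + k)) ∈ A}
      = ⋃ w, {ω | ω 1 ∈ D} ∩ {ω | ω 1 = w} ∩ {ω | (fun k => ω (1 + k)) ∈ A} := by
    ext ω; simp
  rw [hmap, hun, measure_iUnion]
  · refine tsum_congr fun w => ?_
    rw [X.markov z 1 w A _ hA fun ω ω' h hω => by simpa [← h 1 le_rfl] using hω]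
    by_cases hw : w ∈ D
    · have : {ω : ℕ → E | ω 1 ∈ D} ∩ {ω | ω 1 = w} = {ω | ω 1 = w} := by
        ext ω; simp +contextual [hw]
      rw [this, Set.indicator_of_mem hw, mul_comm]
    · have : {ω : ℕ → E | ω 1 ∈ D} ∩ {ω | ω 1 = w} = ∅ := by
        refine Set.eq_empty_of_forall_notMem ?_
        rintro ω ⟨h, rfl⟩
        exact hw h
      simp [this, hw]
  · intro w w' hww
    refine Set.disjoint_left.2 fun ω h h' => hww ?_
    exact h.1.2.symm.trans h'.1.2
  · exact fun w => ((measurableSet_eval D 1).inter (measurableSet_eval {w} 1)).inter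
      (measurable_shift 1 hA)

lemma measure_avoid_succ (X : MChain E) (a z : E) (n : ℕ) :
    X.P z (avoid a (n + 1)) = X.killedStep a (fun w => X.P w (avoid a n)) z := by
  rw [killedStep, ← X.measure_step z _ (measurableSet_avoid a n)]
  congr 1
  ext ω
  constructor
  · exact fun h => ⟨h 1 le_rfl (by omega), fun k _ _ => h (1 + k) (by omega) (by omega)⟩
  · rintro ⟨h1, h⟩ k hk hkn
    obtain rfl | hk' := hk.eq_or_lt
    · exact h1
    · have : ω (1 + (k - 1)) ≠ a := h (k - 1) (by omega) (by omega)
      rwa [show 1 + (k - 1) = k by omega] at this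

lemma killedStep_add (X : MChain E) (a : E) (g h : E → ℝ≥0∞) :
    X.killedStep a (g + h) = X.killedStep a g + X.killedStep a h := by
  funext z
  rw [Pi.add_apply, killedStep, killedStep, killedStep,
    ← lintegral_add_left (measurable_comp_eval _ 1), Set.indicator_add']
  rfl

lemma killedStep_const_mul (X : MChain E) (a : E) (c : ℝ≥0∞) (g : E → ℝ≥0∞) (z : E) :
    X.killedStep a (fun w => c * g w) z = c * X.killedStep a g z := by
  rw [killedStep, killedStep, ← lintegral_const_mul _ (measurable_comp_eval _ 1)]
  refine lintegral_congr fun ω => ?_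
  by_cases h : ω 1 ∈ ({a}ᶜ : Set E) <;> simp [h]

lemma expReturn_succ (X : MChain E) (a z : E) (n : ℕ) :
    X.expReturn a (n + 1) z = 1 + X.killedStep a (X.expReturn a n) z := by
  induction n with
  | zero => simp [expReturn, killedStep, measure_avoid_zero, Set.indicator]
  | succ n ih =>
    have h : X.expReturn a (n + 1) = X.expReturn a n + fun z => X.P z (avoid a n) :=
      funext fun z => Finset.sum_range_succ _ _
    have h' : X.expReturn a (n + 1 + 1) z = X.expReturn a (n + 1) z + X.P z (avoid a (n + 1)) :=
      Finset.sum_range_succ _ _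
    rw [h', ih, measure_avoid_succ, h, killedStep_add, Pi.add_apply, add_assoc]

lemma Irreducible.exists_pos_visit [Nontrivial E] {X : MChain E} (hX : X.Irreducible) (z w : E) :
    ∃ n, 1 ≤ n ∧ X.P z {ω | ω n = w} ≠ 0 := by
  have key : ∀ z w : E, z ≠ w → ∃ n, 1 ≤ n ∧ X.P z {ω | ω n = w} ≠ 0 := by
    intro z w hzw
    obtain ⟨n, hn⟩ := hX z w
    refine ⟨n, Nat.one_le_iff_ne_zero.2 ?_, hn⟩
    rintro rfl
    refine hn (measure_mono_null (fun ω hω => ?_) (X.ae_start z))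
    exact fun h => hzw (h.symm.trans hω)
  by_cases hzw : z = w
  · subst hzw
    obtain ⟨b, hb⟩ := exists_ne z
    obtain ⟨n, hn, hn'⟩ := key z b hb.symm
    obtain ⟨m, -, hm'⟩ := key b z hb
    refine ⟨n + m, by omega, fun h0 => mul_ne_zero hn' hm' ?_⟩
    have := X.markov z n b {ω | ω m = z} Set.univ (measurableSet_eval {z} m) (by simp)
    rw [Set.univ_inter] at this
    rw [← this]
    exact measure_mono_null (fun ω hω => hω.2) h0
  · exact key z w hzw

lemma Irreducible.exists_measure_avoid_lt_one [Nontrivial E] {X : MChain E} (hX : X.Irreducible)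
    (z a : E) : ∃ n, X.P z (avoid a n) < 1 := by
  obtain ⟨n, hn, h⟩ := hX.exists_pos_visit z a
  refine ⟨n, lt_of_le_of_ne prob_le_one fun h1 => h ?_⟩
  have := (prob_compl_eq_zero_iff (measurableSet_avoid a n)).2 h1
  refine measure_mono_null ?_ this
  exact fun ω hω h' => h' n hn le_rfl hω

/-- An irreducible recurrent chain visits every state. -/
lemma Irreducible.measure_never_visit {X : MChain E} (hX : X.Irreducible)
    (hR : X.Recurrent) (z a : E) : X.P z {ω | ∀ k, ω k ≠ a} = 0 := by
  have hnv : MeasurableSet {ω : ℕ → E | ∀ k, ω k ≠ a} := by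
    have : {ω : ℕ → E | ∀ k, ω k ≠ a} = ⋂ k, {ω | ω k ∈ ({a}ᶜ : Set E)} := by ext; simp
    rw [this]
    exact .iInter fun k => measurableSet_eval _ k
  have hnr : MeasurableSet {ω : ℕ → E | ∃ n, 1 ≤ n ∧ ω n = a} := by
    have : {ω : ℕ → E | ∃ n, 1 ≤ n ∧ ω n = a} = ⋃ n, ⋃ (_ : 1 ≤ n), {ω | ω n ∈ ({a} : Set E)} := by
      ext; simp
    rw [this]
    exact .iUnion fun k => .iUnion fun _ => measurableSet_eval _ k
  have hret : X.P a {ω : ℕ → E | ∃ n, 1 ≤ n ∧ ω n = a}ᶜ = 0 :=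
    (prob_compl_eq_zero_iff hnr).2 (hR a)
  have hlast : ∀ n, X.P a {ω | ∀ k, n < k → ω k ≠ a} = 0 := by
    intro n
    have hk : ∀ k, X.P a ({ω | ω k = a} ∩
        {ω | (fun l => ω (k + l)) ∈ {ω : ℕ → E | ∃ n, 1 ≤ n ∧ ω n = a}ᶜ}) = 0 := by
      intro k
      have := X.markov a k a _ Set.univ hnr.compl (by simp)
      rwa [Set.univ_inter, hret, mul_zero] at this
    refine measure_mono_null ?_ (measure_union_null (X.ae_start a) (measure_iUnion_null hk))
    intro ω hω
    by_cases h0 : ω 0 = a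
    · right
      classical
      let k := Nat.findGreatest (fun k => ω k = a) n
      have hka : ω k = a := Nat.findGreatest_spec (P := fun k => ω k = a) (Nat.zero_le n) h0
      refine Set.mem_iUnion.2 ⟨k, hka, ?_⟩
      rintro ⟨l, hl, hla⟩
      by_cases hkl : k + l ≤ n
      · have := Nat.le_findGreatest (P := fun k => ω k = a) hkl hla
        change k + l ≤ k at this
        omega
      · exact hω _ (by omega) hla
    · exact Or.inl h0
  obtain ⟨n, hn⟩ := hX a z
  have hm := X.markov a n z _ Set.univ hnv (by simp)
  rw [Set.univ_inter] at hm
  have h0 : X.P a {ω | ω n = z} * X.P z {ω | ∀ k, ω k ≠ a} = 0 := by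
    rw [← hm]
    refine measure_mono_null ?_ (hlast n)
    intro ω hω k hk
    have : ω (n + (k - n)) ≠ a := hω.2 (k - n)
    rwa [show n + (k - n) = k by omega] at this
  exact (mul_eq_zero.1 h0).resolve_left hn

/-- Foster's criterion, with the bound on the tails of the return time. -/
lemma Irreducible.tsum_measure_avoid_ne_top [Nontrivial E] {X : MChain E} (hX : X.Irreducible)
    (A : Finset E) (f : E → ℝ≥0∞) (hf : ∀ z, f z ≠ ⊤)
    (hstep : ∀ z, ∫⁻ ω, f (ω 1) ∂(X.P z) ≠ ⊤)
    (hdrift : ∀ z, z ∉ A → 1 + ∫⁻ ω, f (ω 1) ∂(X.P z) ≤ f z) (a z : E) :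
    ∑' n, X.P z (avoid a n) ≠ ⊤ := by
  classical
  let b : ℝ≥0∞ := A.sup fun z => ∫⁻ ω, f (ω 1) ∂(X.P z)
  have hb : b ≠ ⊤ := ((Finset.sup_lt_iff bot_lt_top).2 fun z _ => (hstep z).lt_top).ne
  have hfb : ∀ z, ∫⁻ ω, f (ω 1) ∂(X.P z) ≤ f z + b := by
    intro z
    by_cases hz : z ∈ A
    · exact (Finset.le_sup (f := fun z => ∫⁻ ω, f (ω 1) ∂(X.P z)) hz).trans le_add_self
    · exact le_add_self.trans ((hdrift z hz).trans le_self_add)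
  choose N hN using fun z => hX.exists_measure_avoid_lt_one z a
  let m : ℕ := A.sup N
  let θ : ℝ≥0∞ := A.sup fun z => X.P z (avoid a m)
  have hθ : θ < 1 := (Finset.sup_lt_iff (by simp)).2 fun z hz =>
    (measure_mono (avoid_antitone a (Finset.le_sup hz))).trans_lt (hN z)
  let w : ℕ → ℝ≥0∞ := fun n => A.sup (X.expReturn a n)
  have hw : ∀ n, w n ≠ ⊤ := fun n =>
    ((Finset.sup_le fun z _ => X.expReturn_le a n z).trans_lt (ENNReal.natCast_lt_top n)).ne
  have hwmono : Monotone w := fun n n' h => Finset.sup_mono_fun fun z _ => X.expReturn_mono a z h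
  have hconst : ∀ (c : ℝ≥0∞) z, X.killedStep a (fun _ => c) z ≤ c := fun c z =>
    (X.killedStep_le a _ z).trans (by simp)
  have h0 : ∀ n z, X.expReturn a n z ≤ f z + w n := by
    intro n
    induction n with
    | zero => simp [expReturn]
    | succ n ih =>
      intro z
      by_cases hz : z ∈ A
      · exact (Finset.le_sup (f := X.expReturn a (n + 1)) hz).trans le_add_self
      · calc X.expReturn a (n + 1) z
            = 1 + X.killedStep a (X.expReturn a n) z := X.expReturn_succ a z n
          _ ≤ 1 + X.killedStep a (f + fun _ => w n) z := by
              gcongr; exact X.killedStep_mono a ih z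
          _ ≤ 1 + (∫⁻ ω, f (ω 1) ∂(X.P z) + w n) := by
              rw [killedStep_add, Pi.add_apply]
              gcongr
              · exact X.killedStep_le a f z
              · exact hconst _ z
          _ ≤ f z + w (n + 1) := by
              rw [← add_assoc]
              gcongr
              · exact hdrift z hz
              · exact hwmono n.le_succ
  have hiter : ∀ n k z, X.expReturn a (n + k) z
      ≤ f z + k * (1 + b) + w n * X.P z (avoid a k) := by
    intro n k
    induction k with
    | zero => intro z; simpa [measure_avoid_zero] using h0 n z
    | succ k ih =>
      intro z
      calc X.expReturn a (n + k + 1) z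
          = 1 + X.killedStep a (X.expReturn a (n + k)) z := X.expReturn_succ a z _
        _ ≤ 1 + X.killedStep a ((f + fun _ => k * (1 + b)) +
              fun z => w n * X.P z (avoid a k)) z := by
            gcongr; exact X.killedStep_mono a ih z
        _ ≤ 1 + (f z + b + k * (1 + b) + w n * X.P z (avoid a (k + 1))) := by
            rw [killedStep_add, killedStep_add, Pi.add_apply, Pi.add_apply,
              X.killedStep_const_mul a (w n), ← measure_avoid_succ]
            gcongr
            · exact (X.killedStep_le a f z).trans (hfb z)
            · exact hconst _ z
        _ = f z + (k + 1 : ℕ) * (1 + b) + w n * X.P z (avoid a (k + 1)) := by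
            push_cast; ring
  let c : ℝ≥0∞ := A.sup f + m * (1 + b)
  have hc : c ≠ ⊤ := by
    refine ENNReal.add_ne_top.2 ⟨?_, ENNReal.mul_ne_top (by simp) (by simp [hb])⟩
    exact ((Finset.sup_lt_iff bot_lt_top).2 fun z _ => (hf z).lt_top).ne
  have hwc : ∀ n, w n ≤ c + w n * θ := by
    intro n
    refine (hwmono (Nat.le_add_right n m)).trans (Finset.sup_le fun z hz => ?_)
    refine (hiter n m z).trans ?_
    change _ ≤ A.sup f + m * (1 + b) + w n * θ
    gcongr
    · exact Finset.le_sup hz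
    · exact Finset.le_sup (f := fun z => X.P z (avoid a m)) hz
  have hwb : ∀ n, w n ≤ c / (1 - θ) := by
    intro n
    have hθ1 : 1 - θ ≠ 0 := (tsub_pos_of_lt hθ).ne'
    rw [ENNReal.le_div_iff_mul_le (.inl hθ1) (.inl (by simp)),
      ENNReal.mul_sub (fun _ _ => hw n), mul_one]
    exact tsub_le_iff_right.2 (hwc n)
  rw [ENNReal.tsum_eq_iSup_nat]
  refine ((iSup_le fun n => (h0 n z).trans (add_le_add_right (hwb n) (f z))).trans_lt ?_).ne
  exact ENNReal.add_lt_top.2 ⟨(hf z).lt_top,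
    ENNReal.div_lt_top hc (tsub_pos_of_lt hθ).ne'⟩

/-- Foster's criterion for positive recurrence. -/
theorem Irreducible.positiveRecurrent [Nontrivial E] {X : MChain E} (hX : X.Irreducible)
    (A : Finset E) (f : E → ℝ≥0∞) (hf : ∀ z, f z ≠ ⊤)
    (hstep : ∀ z, ∫⁻ ω, f (ω 1) ∂(X.P z) ≠ ⊤)
    (hdrift : ∀ z, z ∉ A → 1 + ∫⁻ ω, f (ω 1) ∂(X.P z) ≤ f z) : X.PositiveRecurrent := by
  have hsum := fun z => hX.tsum_measure_avoid_ne_top A f hf hstep hdrift z z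
  refine ⟨fun z => ?_, fun z => ne_top_of_le_ne_top (hsum z) ?_⟩
  · have hcompl : X.P z {ω | ∃ n, 1 ≤ n ∧ ω n = z}ᶜ = 0 := by
      refine le_antisymm (ge_of_tendsto' (ENNReal.tendsto_atTop_zero_of_tsum_ne_top (hsum z))
        fun n => measure_mono fun ω hω k hk _ hkz => hω ⟨k, hk, hkz⟩) zero_le
    have hmeas : MeasurableSet {ω : ℕ → E | ∃ n, 1 ≤ n ∧ ω n = z} := by
      have : {ω : ℕ → E | ∃ n, 1 ≤ n ∧ ω n = z}
          = ⋃ n, ⋃ (_ : 1 ≤ n), {ω | ω n ∈ ({z} : Set E)} := by ext; simp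
      rw [this]
      exact .iUnion fun k => .iUnion fun _ => measurableSet_eval _ k
    exact (prob_compl_eq_zero_iff hmeas).1 hcompl
  · calc ∫⁻ ω, (returnTime z ω : ℝ≥0∞) ∂(X.P z)
        ≤ ∫⁻ ω, ∑' n, (avoid z n).indicator 1 ω ∂(X.P z) := by
          refine lintegral_mono fun ω => ?_
          calc (returnTime z ω : ℝ≥0∞)
              = ∑ n ∈ Finset.range (returnTime z ω), 1 := by simp
            _ = ∑ n ∈ Finset.range (returnTime z ω), (avoid z n).indicator 1 ω := by
              refine Finset.sum_congr rfl fun n hn => ?_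
              rw [Set.indicator_of_mem]
              · rfl
              · exact fun k hk hkn hkz => absurd (Nat.sInf_le (s := {n | 1 ≤ n ∧ ω n = z})
                  ⟨hk, hkz⟩) (by have := Finset.mem_range.1 hn; unfold returnTime at this; omega)
            _ ≤ _ := ENNReal.sum_le_tsum _
      _ = ∑' n, X.P z (avoid z n) := by
          rw [lintegral_tsum fun n =>
            (measurable_one.indicator (measurableSet_avoid z n)).aemeasurable]
          exact tsum_congr fun n => lintegral_indicator_one (measurableSet_avoid z n)

/-- The maximal inequality behind the transience criterion: a nonnegative function that is
superharmonic off `A` and at least `m` on `A` controls the probability of hitting `A`. -/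
lemma mul_measure_hit_le (X : MChain E) (A : Set E) (g : E → ℝ≥0∞) (m : ℝ≥0∞)
    (hA : ∀ z ∈ A, m ≤ g z) (hg : ∀ z, z ∉ A → ∫⁻ ω, g (ω 1) ∂(X.P z) ≤ g z) (z : E) :
    m * X.P z {ω | ∃ k, ω k ∈ A} ≤ g z := by
  have hmeas : ∀ n, MeasurableSet {ω : ℕ → E | ∃ k ≤ n, ω k ∈ A} := by
    intro n
    have : {ω : ℕ → E | ∃ k ≤ n, ω k ∈ A} = ⋃ k, ⋃ (_ : k ≤ n), {ω | ω k ∈ A} := by ext; simp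
    rw [this]
    exact .iUnion fun k => .iUnion fun _ => measurableSet_eval _ k
  have hn : ∀ n z, m * X.P z {ω | ∃ k ≤ n, ω k ∈ A} ≤ g z := by
    intro n
    induction n with
    | zero =>
      intro z
      by_cases hz : z ∈ A
      · exact (mul_le_of_le_one_right' prob_le_one).trans (hA z hz)
      · have : X.P z {ω | ∃ k ≤ 0, ω k ∈ A} = 0 := by
          refine measure_mono_null ?_ (X.ae_start z)
          rintro ω ⟨k, hk, hkA⟩ h0
          obtain rfl : k = 0 := by omega
          exact hz (h0 ▸ hkA)
        rw [this, mul_zero]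
        exact zero_le
    | succ n ih =>
      intro z
      by_cases hz : z ∈ A
      · exact (mul_le_of_le_one_right' prob_le_one).trans (hA z hz)
      · have hle : X.P z {ω | ∃ k ≤ n + 1, ω k ∈ A}
            ≤ X.P z {ω | ω 1 ∈ Set.univ ∧
                (fun k => ω (1 + k)) ∈ {ω : ℕ → E | ∃ k ≤ n, ω k ∈ A}} := by
          refine measure_mono_ae ?_
          filter_upwards [X.ae_start z] with ω h0
          rintro ⟨k, hk, hkA⟩
          obtain rfl | hk' := Nat.eq_zero_or_pos k
          · exact absurd (h0 ▸ hkA) hz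
          · refine ⟨trivial, k - 1, by omega, ?_⟩
            rwa [show 1 + (k - 1) = k by omega]
        rw [X.measure_step z _ (hmeas n), Set.indicator_univ] at hle
        calc m * X.P z {ω | ∃ k ≤ n + 1, ω k ∈ A}
            ≤ m * ∫⁻ ω, X.P (ω 1) {ω | ∃ k ≤ n, ω k ∈ A} ∂(X.P z) := by gcongr
          _ = ∫⁻ ω, m * X.P (ω 1) {ω | ∃ k ≤ n, ω k ∈ A} ∂(X.P z) :=
              (lintegral_const_mul _
                (measurable_comp_eval (fun w => X.P w {ω | ∃ k ≤ n, ω k ∈ A}) 1)).symm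
          _ ≤ ∫⁻ ω, g (ω 1) ∂(X.P z) := lintegral_mono fun ω => ih (ω 1)
          _ ≤ g z := hg z hz
  have hun : {ω : ℕ → E | ∃ k, ω k ∈ A} = ⋃ n, {ω | ∃ k ≤ n, ω k ∈ A} := by
    ext ω
    simp only [Set.mem_iUnion]
    exact ⟨fun ⟨k, hk⟩ => ⟨k, k, le_rfl, hk⟩, fun ⟨_, k, _, hk⟩ => ⟨k, hk⟩⟩
  have hmono : Monotone fun n => {ω : ℕ → E | ∃ k ≤ n, ω k ∈ A} :=
    fun _ _ h ω ⟨k, hk, hkA⟩ => ⟨k, hk.trans h, hkA⟩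
  rw [hun, hmono.measure_iUnion, ENNReal.mul_iSup]
  exact iSup_le fun n => hn n z

/-- Transience criterion. -/
theorem Irreducible.transient {X : MChain E} (hX : X.Irreducible)
    (A : Set E) (g : E → ℝ≥0∞) (m : ℝ≥0∞) (hne : A.Nonempty) (hA : ∀ z ∈ A, m ≤ g z)
    (hg : ∀ z, z ∉ A → ∫⁻ ω, g (ω 1) ∂(X.P z) ≤ g z) {z : E} (hz : g z < m) :
    X.Transient := by
  intro hR
  obtain ⟨a, ha⟩ := hne
  have h1 : X.P z {ω | ∃ k, ω k ∈ A} = 1 := by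
    refine le_antisymm prob_le_one ?_
    rw [← measure_univ (μ := X.P z)]
    refine measure_mono_ae ?_
    filter_upwards [show ∀ᵐ ω ∂(X.P z), ¬ ∀ k, ω k ≠ a from
      measure_mono_null (fun ω h => not_not.1 h) (hX.measure_never_visit hR z a)] with ω h _
    push Not at h
    obtain ⟨k, hk⟩ := h
    exact ⟨k, hk ▸ ha⟩
  have := X.mul_measure_hit_le A g m hA hg z
  rw [h1, mul_one] at this
  exact absurd hz this.not_gt

end Abstract

end MChain

section Poisson

omit [MeasurableSpace S] [MeasurableSingletonClass S] [Nonempty S]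

/-- A harmonic function of an irreducible stochastic matrix is constant. -/
lemma IsIrreducibleMatrix.eq_of_harmonic {Q : S → S → ℝ} (hi : IsIrreducibleMatrix Q)
    (hs : IsStochasticMatrix Q) {h : S → ℝ} (hh : (Matrix.of Q).mulVec h = h) (i j : S) :
    h i = h j := by
  have hnn : ∀ n i j, 0 ≤ ((Matrix.of Q) ^ n) i j := by
    intro n
    induction n with
    | zero => intro i j; rw [pow_zero, Matrix.one_apply]; split_ifs <;> norm_num
    | succ n ih =>
      intro i j
      rw [pow_succ, Matrix.mul_apply]
      exact Finset.sum_nonneg fun k _ => mul_nonneg (ih i k) (hs.1 k j)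
  have hpow : ∀ v : S → ℝ, (Matrix.of Q).mulVec v = v →
      ∀ n, ((Matrix.of Q) ^ n).mulVec v = v := by
    intro v hv n
    induction n with
    | zero => simp
    | succ n ih => rw [pow_succ, ← Matrix.mulVec_mulVec, hv, ih]
  have h1 : (Matrix.of Q).mulVec (fun _ => (1 : ℝ)) = fun _ => 1 := by
    funext i
    simpa [Matrix.mulVec, dotProduct] using hs.2 i
  have : Nonempty S := ⟨i⟩
  obtain ⟨m, hm⟩ := Finite.exists_max h
  have key : ∀ k, h k = h m := by
    intro k
    obtain ⟨n, hn⟩ := hi m k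
    have e1 := congrFun (hpow _ hh n) m
    have e2 := congrFun (hpow _ h1 n) m
    simp only [Matrix.mulVec, dotProduct, mul_one] at e1 e2
    have hsum : ∑ l, ((Matrix.of Q) ^ n) m l * (h m - h l) = 0 := by
      simp only [mul_sub, Finset.sum_sub_distrib, ← Finset.sum_mul, e1, e2]
      ring
    have := (Finset.sum_eq_zero_iff_of_nonneg fun l _ =>
      mul_nonneg (hnn n m l) (sub_nonneg.2 (hm l))).1 hsum k (Finset.mem_univ k)
    linarith [(mul_eq_zero.1 this).resolve_left hn.ne']
  rw [key i, key j]

/-- The Poisson equation of an irreducible stochastic matrix. -/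
lemma IsIrreducibleMatrix.exists_poisson {Q : S → S → ℝ} (hi : IsIrreducibleMatrix Q)
    (hs : IsStochasticMatrix Q) {pst : S → ℝ} (hpst : IsStationaryDist Q pst) (d : S → ℝ) :
    ∃ h : S → ℝ, (∀ i, 0 ≤ h i) ∧ ∀ i, d i + ∑ j, Q i j * h j - h i = ∑ j, d j * pst j := by
  let L : (S → ℝ) →ₗ[ℝ] (S → ℝ) := (Matrix.of Q).mulVecLin - LinearMap.id
  let φ : (S → ℝ) →ₗ[ℝ] ℝ := ∑ i, pst i • LinearMap.proj i
  have hφ : ∀ v, φ v = ∑ i, pst i * v i := fun v => by simp [φ]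
  have hL : ∀ v i, L v i = ∑ j, Q i j * v j - v i := fun v i => by
    simp [L, Matrix.mulVec, dotProduct]
  have hle : LinearMap.range L ≤ LinearMap.ker φ := by
    rintro _ ⟨v, rfl⟩
    rw [LinearMap.mem_ker, hφ]
    simp only [hL, mul_sub, Finset.sum_sub_distrib, Finset.mul_sum]
    rw [Finset.sum_comm]
    simp only [← mul_assoc, ← Finset.sum_mul, hpst.2.2, sub_self]
  have hker : LinearMap.ker L ≤ Submodule.span ℝ {fun _ => (1 : ℝ)} := by
    intro v hv
    have hv' : (Matrix.of Q).mulVec v = v := sub_eq_zero.1 (LinearMap.mem_ker.1 hv)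
    by_cases hS : Nonempty S
    · obtain ⟨i⟩ := hS
      refine Submodule.mem_span_singleton.2 ⟨v i, funext fun j => ?_⟩
      simpa using hi.eq_of_harmonic hs hv' i j
    · have := not_nonempty_iff.1 hS
      rw [Subsingleton.elim v 0]
      exact Submodule.zero_mem _
  have hφsurj : LinearMap.range φ = ⊤ := by
    refine LinearMap.range_eq_top.2 fun c => ⟨fun _ => c, ?_⟩
    rw [hφ, ← Finset.sum_mul, hpst.2.1, one_mul]
  have hrange : LinearMap.range L = LinearMap.ker φ := by
    refine Submodule.eq_of_le_of_finrank_le hle ?_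
    have r1 := LinearMap.finrank_range_add_finrank_ker L
    have r2 := LinearMap.finrank_range_add_finrank_ker φ
    have r3 := (Submodule.finrank_mono hker).trans (finrank_span_le_card _)
    rw [hφsurj, finrank_top, Module.finrank_self] at r2
    simp only [Set.toFinset_singleton, Finset.card_singleton] at r3
    omega
  have hmem : (fun i => (∑ j, d j * pst j) - d i) ∈ LinearMap.range L := by
    rw [hrange, LinearMap.mem_ker, hφ]
    simp only [mul_sub, Finset.sum_sub_distrib, ← Finset.sum_mul, hpst.2.1, one_mul]
    rw [sub_eq_zero]
    exact Finset.sum_congr rfl fun i _ => mul_comm _ _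
  obtain ⟨h, hh⟩ := hmem
  refine ⟨fun i => h i + ∑ j, |h j|, fun i => ?_, fun i => ?_⟩
  · have := Finset.single_le_sum (f := fun j => |h j|) (fun j _ => abs_nonneg _)
      (Finset.mem_univ i)
    linarith [neg_abs_le (h i)]
  · have := congrFun hh i
    rw [hL] at this
    simp only [mul_add, Finset.sum_add_distrib, ← Finset.sum_mul, hs.2]
    linarith

end Poisson

/-- A Taylor-type bound for `u ↦ u ^ (-α)` on `[1, ∞)`, with an error term of order `q ∈ [1, 2]`. -/
lemma rpow_neg_add_le {α q F Δ : ℝ} (hα0 : 0 ≤ α) (hα1 : α ≤ 1) (hq1 : 1 ≤ q) (hq2 : q ≤ 2)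
    (hF : 1 ≤ F) (hFΔ : 1 ≤ F + Δ) :
    (F + Δ) ^ (-α) ≤ F ^ (-α) - α * F ^ (-α - 1) * Δ + 4 * F ^ (-q) * |Δ| ^ q := by
  have hF0 : 0 < F := by linarith
  obtain ⟨t, rfl⟩ : ∃ t, Δ = F * t := ⟨Δ / F, by field_simp⟩
  have ht1 : 0 < 1 + t := by
    have : 0 < F * (1 + t) := by linarith
    exact pos_of_mul_pos_right this hF0.le
  have hFa : F ^ (-α) ≤ 1 := Real.rpow_le_one_of_one_le_of_nonpos hF (by linarith)
  have hFa0 : 0 < F ^ (-α) := Real.rpow_pos_of_pos hF0 _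
  have htq : 0 ≤ |t| ^ q := by positivity
  have e1 : α * F ^ (-α - 1) * (F * t) = F ^ (-α) * (α * t) := by
    rw [Real.rpow_sub_one hF0.ne']; field_simp
  have e2 : 4 * F ^ (-q) * |F * t| ^ q = 4 * |t| ^ q := by
    rw [abs_mul, abs_of_pos hF0, Real.mul_rpow hF0.le (abs_nonneg t), Real.rpow_neg hF0.le]
    field_simp
  rw [e1, e2]
  by_cases ht : -(1 / 2) ≤ t
  · have hb : (1 + t) ^ (-α) ≤ 1 - α * t + 2 * |t| ^ q := by
      have hinv : (1 + t) ^ (-α) = (1 + -(t / (1 + t))) ^ α := by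
        rw [Real.rpow_neg ht1.le, ← Real.inv_rpow ht1.le]
        congr 1
        field_simp
        ring
      have hbern : (1 + -(t / (1 + t))) ^ α ≤ 1 + α * -(t / (1 + t)) := by
        refine rpow_one_add_le_one_add_mul_self ?_ hα0 hα1
        rw [neg_le_neg_iff, div_le_one ht1]
        linarith
      have hsq : t ^ 2 / (1 + t) ≤ 2 * |t| ^ q := by
        rw [div_le_iff₀ ht1]
        by_cases h1 : |t| ≤ 1
        · have : t ^ 2 ≤ |t| ^ q := by
            rw [← sq_abs, ← Real.rpow_natCast]
            exact Real.rpow_le_rpow_of_exponent_ge' (abs_nonneg t) h1 (by linarith)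
              (by exact_mod_cast hq2)
          nlinarith
        · push Not at h1
          have htpos : 0 < t := by
            by_contra h
            rw [abs_of_nonpos (not_lt.1 h)] at h1
            linarith
          have : t ≤ |t| ^ q := by
            calc t ≤ |t| := le_abs_self t
              _ ≤ |t| ^ q := Real.self_le_rpow_of_one_le h1.le hq1
          nlinarith
      have : 1 + α * -(t / (1 + t)) = 1 - α * t + α * (t ^ 2 / (1 + t)) := by
        field_simp
        ring
      have h0 : 0 ≤ t ^ 2 / (1 + t) := by positivity
      nlinarith
    calc (F + F * t) ^ (-α) = F ^ (-α) * (1 + t) ^ (-α) := by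
          rw [← Real.mul_rpow hF0.le ht1.le]; ring_nf
      _ ≤ F ^ (-α) * (1 - α * t + 2 * |t| ^ q) := by gcongr
      _ = F ^ (-α) - F ^ (-α) * (α * t) + F ^ (-α) * (2 * |t| ^ q) := by ring
      _ ≤ _ := by nlinarith
  · push Not at ht
    have h1 : (F + F * t) ^ (-α) ≤ 1 := Real.rpow_le_one_of_one_le_of_nonpos hFΔ (by linarith)
    have h2 : 1 / 4 ≤ |t| ^ q := by
      calc (1 / 4 : ℝ) = (1 / 2) ^ (2 : ℝ) := by norm_num
        _ ≤ (1 / 2) ^ q := Real.rpow_le_rpow_of_exponent_ge (by norm_num) (by norm_num) hq2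
        _ ≤ |t| ^ q := by
          refine Real.rpow_le_rpow (by norm_num) ?_ (by linarith)
          rw [abs_of_neg (by linarith)]
          linarith
    have h3 : F ^ (-α) * (α * t) ≤ 0 :=
      mul_nonpos_of_nonneg_of_nonpos hFa0.le
        (mul_nonpos_of_nonneg_of_nonpos hα0 (by linarith))
    linarith

section Jumps

omit [DecidableEq S] [Nonempty S] in
lemma CondB.integrable_jump {X : MChain (ℕ × S)} {p : ℝ} (hB : CondB X p) {q : ℝ} (hq0 : 0 < q)
    (hqp : q ≤ p) : ∃ C : ℝ, 0 ≤ C ∧ ∀ (x : ℕ) i,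
      Integrable (fun ω : ℕ → ℕ × S => |((ω 1).1 : ℝ) - x| ^ q) (X.P (x, i)) ∧
      ∫ ω, |((ω 1).1 : ℝ) - x| ^ q ∂(X.P (x, i)) ≤ C := by
  obtain ⟨C, hC, hb⟩ := hB
  refine ⟨C.toReal, ENNReal.toReal_nonneg, fun x i => ?_⟩
  have hle : ∫⁻ ω, ENNReal.ofReal (|((ω 1).1 : ℝ) - x| ^ q) ∂(X.P (x, i)) ≤ C := by
    refine (lintegral_mono fun ω => ENNReal.ofReal_le_ofReal ?_).trans (hb x i)
    by_cases h : (ω 1).1 = x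
    · simp [h, hq0.ne', (hq0.trans_le hqp).ne']
    · refine Real.rpow_le_rpow_of_exponent_le ?_ hqp
      have : (1 : ℤ) ≤ |((ω 1).1 : ℤ) - x| := Int.one_le_abs (by omega)
      exact_mod_cast this
  have hmeas : Measurable fun ω : ℕ → ℕ × S => |((ω 1).1 : ℝ) - x| ^ q :=
    (measurable_of_countable fun w : ℕ × S => |(w.1 : ℝ) - x| ^ q).comp (measurable_pi_apply 1)
  have hnn : ∀ ω : ℕ → ℕ × S, 0 ≤ |((ω 1).1 : ℝ) - x| ^ q := fun ω => by positivity
  refine ⟨⟨hmeas.aestronglyMeasurable, ?_⟩, ?_⟩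
  · rw [hasFiniteIntegral_iff_ofReal (.of_forall hnn)]
    exact hle.trans_lt hC.lt_top
  · rw [integral_eq_lintegral_of_nonneg_ae (.of_forall hnn) hmeas.aestronglyMeasurable]
    exact ENNReal.toReal_mono hC hle

omit [DecidableEq S] [Nonempty S] in
lemma integrable_comp_snd (X : MChain (ℕ × S)) (z : ℕ × S) (h : S → ℝ) :
    Integrable (fun ω : ℕ → ℕ × S => h (ω 1).2) (X.P z) := by
  have hm : Measurable fun ω : ℕ → ℕ × S => (ω 1).2 :=
    measurable_snd.comp (measurable_pi_apply 1)
  have : IsProbabilityMeasure ((X.P z).map fun ω => (ω 1).2) :=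
    Measure.isProbabilityMeasure_map hm.aemeasurable
  exact Integrable.comp_measurable (f := fun ω : ℕ → ℕ × S => (ω 1).2) .of_finite hm

omit [DecidableEq S] [Nonempty S] in
lemma integral_comp_snd (X : MChain (ℕ × S)) (x : ℕ) (i : S) (h : S → ℝ) :
    ∫ ω, h (ω 1).2 ∂(X.P (x, i)) = ∑ j, qhat X x i j * h j := by
  have hm : Measurable fun ω : ℕ → ℕ × S => (ω 1).2 :=
    measurable_snd.comp (measurable_pi_apply 1)
  have hp : IsProbabilityMeasure ((X.P (x, i)).map fun ω => (ω 1).2) :=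
    Measure.isProbabilityMeasure_map hm.aemeasurable
  rw [← integral_map (φ := fun ω : ℕ → ℕ × S => (ω 1).2) hm.aemeasurable
    (measurable_of_countable h).aestronglyMeasurable, integral_fintype .of_finite]
  refine Finset.sum_congr rfl fun j _ => ?_
  rw [measureReal_def, Measure.map_apply hm (measurableSet_singleton j), smul_eq_mul]
  rfl

omit [DecidableEq S] [Nonempty S] in
lemma CondB.integrable_increment {X : MChain (ℕ × S)} {p : ℝ} (hB : CondB X p) (hp : 1 ≤ p)
    (x : ℕ) (i : S) : Integrable (fun ω : ℕ → ℕ × S => ((ω 1).1 : ℝ) - x) (X.P (x, i)) := by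
  obtain ⟨_, -, h⟩ := hB.integrable_jump one_pos hp
  have hmeas : Measurable fun ω : ℕ → ℕ × S => ((ω 1).1 : ℝ) - x :=
    (measurable_of_countable fun w : ℕ × S => (w.1 : ℝ) - x).comp (measurable_pi_apply 1)
  refine (integrable_norm_iff hmeas.aestronglyMeasurable).1 ?_
  simpa using (h x i).1

omit [Nonempty S] in
/-- The increments of `(x, i) ↦ x + h i` along a step of the chain are integrable and have the
limiting mean `d i + ∑ j, Q i j * h j - h i`. -/
lemma tendsto_integral_increment {X : MChain (ℕ × S)} {p : ℝ} (hB : CondB X p) (hp : 1 ≤ p)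
    {Q : S → S → ℝ} (hQ : CondQ X Q) {d : S → ℝ} (hd : CondMC X d) (h : S → ℝ) (i : S) :
    Tendsto (fun x : ℕ => ∫ ω, (((ω 1).1 : ℝ) - x + (h (ω 1).2 - h i)) ∂(X.P (x, i))) atTop
      (𝓝 (d i + ∑ j, Q i j * h j - h i)) := by
  have : ∀ x : ℕ, ∫ ω, (((ω 1).1 : ℝ) - x + (h (ω 1).2 - h i)) ∂(X.P (x, i))
      = stepMoment X 1 x i + ∑ j, qhat X x i j * h j - h i := by
    intro x
    have hi := integrable_comp_snd X (x, i) h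
    have hi' : Integrable (fun ω : ℕ → ℕ × S => h (ω 1).2 - h i) (X.P (x, i)) :=
      hi.sub (integrable_const _)
    rw [integral_add (hB.integrable_increment hp x i) hi',
      integral_sub hi (integrable_const _), integral_comp_snd, stepMoment, integral_const]
    simp only [pow_one, probReal_univ, one_smul]
    ring
  simp only [this]
  exact ((hd i).add (tendsto_finsetSum _ fun j _ => (hQ.1 i j).mul_const _)).sub_const _

end Jumps

omit [DecidableEq S] in
lemma positiveRecurrent_of_eventually_drift {X : MChain (ℕ × S)} (hirr : X.Irreducible) {p : ℝ}
    (hB : CondB X p) (hp : 1 ≤ p) {h : S → ℝ} (hh : ∀ i, 0 ≤ h i) {ε : ℝ} (hε : 0 < ε)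
    (hdrift : ∀ᶠ x : ℕ in atTop, ∀ i,
      ∫ ω, (((ω 1).1 : ℝ) - x + (h (ω 1).2 - h i)) ∂(X.P (x, i)) ≤ -ε) :
    X.PositiveRecurrent := by
  obtain ⟨x₀, hx₀⟩ := eventually_atTop.1 hdrift
  let V : ℕ × S → ℝ := fun w => (w.1 + h w.2) / ε
  have hV : ∀ w, 0 ≤ V w := fun w => div_nonneg (add_nonneg w.1.cast_nonneg (hh _)) hε.le
  have hVeq : ∀ (x : ℕ) i (ω : ℕ → ℕ × S),
      V (ω 1) = V (x, i) + ε⁻¹ * (((ω 1).1 : ℝ) - x + (h (ω 1).2 - h i)) := by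
    intro x i ω
    simp only [V]
    field_simp
    ring
  have hinc : ∀ (x : ℕ) i, Integrable
      (fun ω : ℕ → ℕ × S => ((ω 1).1 : ℝ) - x + (h (ω 1).2 - h i)) (X.P (x, i)) := fun x i =>
    (hB.integrable_increment hp x i).add ((integrable_comp_snd X _ h).sub (integrable_const _))
  have hint : ∀ x i, Integrable (fun ω : ℕ → ℕ × S => V (ω 1)) (X.P (x, i)) := by
    intro x i
    simp only [hVeq x i]
    exact (integrable_const _).add ((hinc x i).const_mul _)
  have hlint : ∀ x i, ∫⁻ ω, ENNReal.ofReal (V (ω 1)) ∂(X.P (x, i))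
      = ENNReal.ofReal (∫ ω, V (ω 1) ∂(X.P (x, i))) := fun x i =>
    (ofReal_integral_eq_lintegral_ofReal (hint x i) (.of_forall fun ω => hV _)).symm
  refine hirr.positiveRecurrent (Finset.range x₀ ×ˢ Finset.univ)
    (fun w => ENNReal.ofReal (V w)) (fun _ => ENNReal.ofReal_ne_top) ?_ ?_
  · rintro ⟨x, i⟩
    rw [hlint]
    exact ENNReal.ofReal_ne_top
  · rintro ⟨x, i⟩ hx
    have hx' : x₀ ≤ x := by simpa using hx
    rw [hlint, ← ENNReal.ofReal_one,
      ← ENNReal.ofReal_add zero_le_one (integral_nonneg fun ω => hV _)]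
    refine ENNReal.ofReal_le_ofReal ?_
    have hmean : ∫ ω, V (ω 1) ∂(X.P (x, i)) = V (x, i) +
        ε⁻¹ * ∫ ω, (((ω 1).1 : ℝ) - x + (h (ω 1).2 - h i)) ∂(X.P (x, i)) := by
      simp only [hVeq x i]
      rw [integral_add (integrable_const _) ((hinc x i).const_mul _), integral_const_mul]
      simp
    have h1 := mul_le_mul_of_nonneg_left (hx₀ x hx' i) (inv_nonneg.2 hε.le)
    rw [mul_neg, inv_mul_cancel₀ hε.ne'] at h1
    linarith

omit [DecidableEq S] in
lemma transient_of_eventually_drift {X : MChain (ℕ × S)} (hirr : X.Irreducible) {p : ℝ}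
    (hB : CondB X p) (hp : 1 < p) {h : S → ℝ} (hh : ∀ i, 0 ≤ h i) {ε : ℝ} (hε : 0 < ε)
    (hdrift : ∀ᶠ x : ℕ in atTop, ∀ i,
      ε ≤ ∫ ω, (((ω 1).1 : ℝ) - x + (h (ω 1).2 - h i)) ∂(X.P (x, i))) :
    X.Transient := by
  obtain ⟨q, hq1, hq2, hqp⟩ : ∃ q : ℝ, 1 < q ∧ q ≤ 2 ∧ q ≤ p :=
    ⟨min 2 p, lt_min (by norm_num) hp, min_le_left _ _, min_le_right _ _⟩
  obtain ⟨C, hC0, hC⟩ := hB.integrable_jump (by linarith) hqp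
  let α : ℝ := (q - 1) / 2
  have hα0 : 0 < α := by simp only [α]; linarith
  have hα1 : α ≤ 1 := by simp only [α]; linarith
  have hαq : q = α + α + 1 := by simp only [α]; ring
  let H : ℝ := ∑ j, h j
  have hH : ∀ i, h i ≤ H := fun i =>
    Finset.single_le_sum (fun j _ => hh j) (Finset.mem_univ i)
  have hH0 : 0 ≤ H := Finset.sum_nonneg fun j _ => hh j
  let M : ℝ := 2 * (C + H ^ q)
  obtain ⟨x₁, hx₁⟩ := eventually_atTop.1 (hdrift.and
    (((tendsto_rpow_atTop hα0).comp tendsto_natCast_atTop_atTop).eventually_ge_atTop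
      (4 * M / (α * ε))))
  let x₀ := x₁ + 1
  have hx₀ : ∀ x, x₀ ≤ x → (∀ i,
      ε ≤ ∫ ω, (((ω 1).1 : ℝ) - x + (h (ω 1).2 - h i)) ∂(X.P (x, i))) ∧
      4 * M / (α * ε) ≤ (x : ℝ) ^ α := fun x hx => hx₁ x (by omega)
  let F : ℕ × S → ℝ := fun w => w.1 + h w.2 + 1
  have hF1 : ∀ w, 1 ≤ F w := fun w => by
    have := hh w.2
    have : (0 : ℝ) ≤ w.1 := w.1.cast_nonneg
    simp only [F]; linarith
  have hF0 : ∀ w, 0 < F w := fun w => one_pos.trans_le (hF1 w)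
  have hFint : ∀ z, Integrable (fun ω : ℕ → ℕ × S => F (ω 1) ^ (-α)) (X.P z) := by
    intro z
    refine Integrable.of_bound (C := 1) ((measurable_of_countable fun w => F w ^ (-α)).comp
      (measurable_pi_apply 1)).aestronglyMeasurable (.of_forall fun ω => ?_)
    rw [Real.norm_of_nonneg (Real.rpow_nonneg (hF0 _).le _)]
    exact Real.rpow_le_one_of_one_le_of_nonpos (hF1 _) (by linarith)
  have hsuper : ∀ x i, x₀ ≤ x → ∫ ω, F (ω 1) ^ (-α) ∂(X.P (x, i)) ≤ F (x, i) ^ (-α) := by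
    intro x i hx
    obtain ⟨hdr, hxα⟩ := hx₀ x hx
    have hptw : ∀ ω : ℕ → ℕ × S, F (ω 1) ^ (-α) ≤ F (x, i) ^ (-α)
        - α * F (x, i) ^ (-α - 1) * (((ω 1).1 : ℝ) - x + (h (ω 1).2 - h i))
        + 4 * F (x, i) ^ (-q) * (2 * (|((ω 1).1 : ℝ) - x| ^ q + H ^ q)) := by
      intro ω
      have hsum : F (ω 1) = F (x, i) + (((ω 1).1 : ℝ) - x + (h (ω 1).2 - h i)) := by
        simp only [F]; ring
      have hb := rpow_neg_add_le hα0.le hα1 hq1.le hq2 (hF1 (x, i)) (hsum ▸ hF1 (ω 1))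
      rw [← hsum] at hb
      refine hb.trans (add_le_add_right (mul_le_mul_of_nonneg_left ?_ ?_) _)
      · have hdiff : |h (ω 1).2 - h i| ≤ H := by
          rw [abs_le]
          constructor <;> linarith [hh i, hh (ω 1).2, hH i, hH (ω 1).2]
        calc |((ω 1).1 : ℝ) - x + (h (ω 1).2 - h i)| ^ q
            ≤ (|((ω 1).1 : ℝ) - x| + H) ^ q := by
              gcongr
              exact (abs_add_le _ _).trans (by gcongr)
          _ ≤ 2 ^ (q - 1) * (|((ω 1).1 : ℝ) - x| ^ q + H ^ q) :=
              NNReal.coe_le_coe.2 (NNReal.rpow_add_le_mul_rpow_add_rpow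
                ⟨|((ω 1).1 : ℝ) - x|, abs_nonneg _⟩ ⟨H, hH0⟩ hq1.le)
          _ ≤ 2 * (|((ω 1).1 : ℝ) - x| ^ q + H ^ q) := by
              gcongr
              calc (2 : ℝ) ^ (q - 1) ≤ 2 ^ (1 : ℝ) :=
                    Real.rpow_le_rpow_of_exponent_le (by norm_num) (by linarith)
                _ = 2 := Real.rpow_one 2
      · exact mul_nonneg (by norm_num) (Real.rpow_nonneg (hF0 _).le _)
    have hinc : Integrable
        (fun ω : ℕ → ℕ × S => ((ω 1).1 : ℝ) - x + (h (ω 1).2 - h i)) (X.P (x, i)) :=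
      (hB.integrable_increment hp.le x i).add
        ((integrable_comp_snd X _ h).sub (integrable_const _))
    have hI1 : Integrable (fun ω : ℕ → ℕ × S => F (x, i) ^ (-α)
        - α * F (x, i) ^ (-α - 1) * (((ω 1).1 : ℝ) - x + (h (ω 1).2 - h i))) (X.P (x, i)) :=
      (integrable_const _).sub (hinc.const_mul _)
    have hI2 : Integrable (fun ω : ℕ → ℕ × S =>
        2 * (|((ω 1).1 : ℝ) - x| ^ q + H ^ q)) (X.P (x, i)) :=
      ((hC x i).1.add (integrable_const _)).const_mul _
    have hM : ∫ ω, 2 * (|((ω 1).1 : ℝ) - x| ^ q + H ^ q) ∂(X.P (x, i)) ≤ M := by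
      rw [integral_const_mul, integral_add (hC x i).1 (integrable_const _), integral_const]
      simp only [probReal_univ, one_smul, M]
      linarith [(hC x i).2]
    have hfin : 4 * F (x, i) ^ (-q) * M ≤ α * F (x, i) ^ (-α - 1) * ε := by
      have hpow : F (x, i) ^ (-α - 1) = F (x, i) ^ (-q) * F (x, i) ^ α := by
        rw [← Real.rpow_add (hF0 _), hαq]
        congr 1
        ring
      have hle : 4 * M ≤ α * ε * F (x, i) ^ α := by
        rw [mul_comm (α * ε), ← div_le_iff₀ (mul_pos hα0 hε)]
        refine hxα.trans (Real.rpow_le_rpow x.cast_nonneg ?_ hα0.le)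
        simp only [F]
        linarith [hh i]
      rw [hpow]
      calc 4 * F (x, i) ^ (-q) * M = F (x, i) ^ (-q) * (4 * M) := by ring
        _ ≤ F (x, i) ^ (-q) * (α * ε * F (x, i) ^ α) :=
          mul_le_mul_of_nonneg_left hle (Real.rpow_nonneg (hF0 _).le _)
        _ = _ := by ring
    have hc1 : 0 ≤ α * F (x, i) ^ (-α - 1) :=
      mul_nonneg hα0.le (Real.rpow_nonneg (hF0 _).le _)
    have hc2 : 0 ≤ 4 * F (x, i) ^ (-q) :=
      mul_nonneg (by norm_num) (Real.rpow_nonneg (hF0 _).le _)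
    have hmono := integral_mono (hFint (x, i)) (hI1.add (hI2.const_mul (4 * F (x, i) ^ (-q)))) hptw
    rw [Pi.add_def, integral_add hI1 (hI2.const_mul _), integral_const_mul,
      integral_sub (integrable_const _) (hinc.const_mul _), integral_const_mul,
      integral_const] at hmono
    simp only [probReal_univ, one_smul] at hmono
    have h1 := mul_le_mul_of_nonneg_left (hdr i) hc1
    have h2 := mul_le_mul_of_nonneg_left hM hc2
    linarith
  obtain ⟨N, hN⟩ := exists_nat_gt ((x₀ : ℝ) + H)
  obtain ⟨s⟩ := ‹Nonempty S›
  refine hirr.transient {w | w.1 < x₀} (fun w => ENNReal.ofReal (F w ^ (-α)))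
    (ENNReal.ofReal ((x₀ + H + 1) ^ (-α))) ⟨(0, s), Nat.succ_pos _⟩ ?_ ?_ (z := (N, s)) ?_
  · intro w hw
    refine ENNReal.ofReal_le_ofReal (Real.rpow_le_rpow_of_nonpos (hF0 w) ?_ (by linarith))
    have : (w.1 : ℝ) ≤ x₀ := by exact_mod_cast (show w.1 < x₀ from hw).le
    simp only [F]
    linarith [hH w.2]
  · rintro ⟨x, i⟩ hx
    rw [← ofReal_integral_eq_lintegral_ofReal (hFint _)
      (.of_forall fun ω => Real.rpow_nonneg (hF0 _).le _)]
    exact ENNReal.ofReal_le_ofReal (hsuper x i (not_lt.1 hx))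
  · have hpos : (0 : ℝ) < x₀ + H + 1 := by positivity
    refine (ENNReal.ofReal_lt_ofReal_iff (Real.rpow_pos_of_pos hpos _)).2
      (Real.rpow_lt_rpow_of_neg hpos ?_ (by linarith))
    simp only [F]
    linarith [hh s]

/-- Theorem 1 (constant drifts): under (B_p) for some `p > 1`, (M_C) and (Q_∞), if
`Σ_i d_i π(i) > 0` then `X_n` is transient, and if `Σ_i d_i π(i) < 0` then `X_n` is
positive-recurrent. -/
theorem stmt2 (X : MChain (ℕ × S)) (hirr : X.Irreducible)
    (p : ℝ) (hp : 1 < p) (hB : CondB X p)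
    (Q : S → S → ℝ) (pst : S → ℝ) (hQ : CondQ X Q) (hpst : IsStationaryDist Q pst)
    (d : S → ℝ) (hd : CondMC X d) :
    ((0 < ∑ i, d i * pst i) → X.Transient) ∧
    ((∑ i, d i * pst i) < 0 → X.PositiveRecurrent) := by
  have hlim : ∃ h : S → ℝ, (∀ i, 0 ≤ h i) ∧ ∀ i, Tendsto
      (fun x : ℕ => ∫ ω, (((ω 1).1 : ℝ) - x + (h (ω 1).2 - h i)) ∂(X.P (x, i))) atTop
      (𝓝 (∑ j, d j * pst j)) := by
    obtain ⟨h, hh, hP⟩ := hQ.2.2.exists_poisson hQ.2.1 hpst d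
    exact ⟨h, hh, fun i => hP i ▸ tendsto_integral_increment hB hp.le hQ hd h i⟩
  obtain ⟨h, hh, hlim⟩ := hlim
  refine ⟨fun hpos => ?_, fun hneg => ?_⟩
  · refine transient_of_eventually_drift hirr hB hp hh (half_pos hpos) ?_
    exact eventually_all.2 fun i => (hlim i).eventually_const_le (half_lt_self hpos)
  · refine positiveRecurrent_of_eventually_drift hirr hB hp.le hh
      (half_pos (neg_pos.2 hneg)) ?_
    exact eventually_all.2 fun i => (hlim i).eventually_le_const (by linarith)
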